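/- Let M be a Coxeter matrix over a finite set S. Then there exist a finite set S̃ containing S and a Coxeter matrix M̃ over S̃ such that the restriction of M̃ to S × S equals M (so the Coxeter graph of M is the full subgraph of the Coxeter graph of M̃ on S) and the canonical bilinear form of M̃ is non-degenerate. -/

import Mathlib

/-!
Statement 5: Let M be a Coxeter matrix over a finite set S. Then there exist a finite set S̃
containing S and a Coxeter matrix M̃ over S̃ whose restriction to S × S equals M and whose
canonical bilinear form is non-degenerate.
-/

noncomputable section

namespace CoxeterPaper

/-- The entry `⟨α_s, α_t⟩` of the canonical bilinear form: `-cos (π / m_{s,t})` if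
`m_{s,t} < ∞`, and `-1` if `m_{s,t} = ∞` (encoded by `M s t = 0`). -/
noncomputable def formEntry {B : Type*} (M : CoxeterMatrix B) (s t : B) : ℝ :=
  if M s t = 0 then -1 else -Real.cos (Real.pi / (M s t : ℝ))

/-- The canonical bilinear form on `V = ⊕_{s ∈ S} ℝ α_s`, identified with `B → ℝ` via the
basis of simple roots. -/
noncomputable def canonicalForm {B : Type*} [Fintype B] (M : CoxeterMatrix B) (x y : B → ℝ) : ℝ :=
  ∑ s, ∑ t, x s * y t * formEntry M s t

/-- The Coxeter matrix on `B ⊕ B` obtained from `M` by attaching to each vertex `s` a pendant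
vertex, joined to `s` by an edge labelled `m`. -/
def pendantExtension {B : Type*} [DecidableEq B] (M : CoxeterMatrix B) (m : ℕ) (hm : m ≠ 1) :
    CoxeterMatrix (B ⊕ B) where
  M := Matrix.fromBlocks M.M (Matrix.of fun s t => if s = t then m else 2)
    (Matrix.of fun s t => if s = t then m else 2) (Matrix.of fun s t => if s = t then 1 else 2)
  isSymm := by
    apply Matrix.IsSymm.ext
    rintro (s | s) (t | t)
    · exact M.symmetric t s
    all_goals simp [eq_comm]
  diagonal := by rintro (s | s) <;> simp
  off_diagonal := by
    rintro (s | s) (t | t) h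
    · exact M.off_diagonal s t (by simpa using h)
    · simp only [Matrix.fromBlocks_apply₁₂, Matrix.of_apply]
      split_ifs <;> omega
    · simp only [Matrix.fromBlocks_apply₂₁, Matrix.of_apply]
      split_ifs <;> omega
    · simp_all

section pendantExtension

variable {B : Type*} [DecidableEq B] (M : CoxeterMatrix B) (m : ℕ) (hm : m ≠ 1) (s t : B)

theorem formEntry_pendantExtension_inl_inl :
    formEntry (pendantExtension M m hm) (.inl s) (.inl t) = formEntry M s t := rfl

theorem formEntry_pendantExtension_inl_inr (h0 : m ≠ 0) :
    formEntry (pendantExtension M m hm) (.inl s) (.inr t) =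
      if s = t then -Real.cos (Real.pi / m) else 0 := by
  by_cases h : s = t <;> simp [formEntry, pendantExtension, h, h0]

theorem formEntry_pendantExtension_inr_inl (h0 : m ≠ 0) :
    formEntry (pendantExtension M m hm) (.inr s) (.inl t) =
      if s = t then -Real.cos (Real.pi / m) else 0 := by
  by_cases h : s = t <;> simp [formEntry, pendantExtension, h, h0]

theorem formEntry_pendantExtension_inr_inr :
    formEntry (pendantExtension M m hm) (.inr s) (.inr t) = if s = t then 1 else 0 := by
  by_cases h : s = t <;> simp [formEntry, pendantExtension, h]

end pendantExtension

theorem canonicalForm_single_right {B : Type*} [Fintype B] [DecidableEq B] (M : CoxeterMatrix B)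
    (x : B → ℝ) (t : B) :
    canonicalForm M x (Pi.single t 1) = ∑ s, x s * formEntry M s t := by
  simp [canonicalForm, Pi.single_apply]

theorem cos_pi_div_sq_injective :
    Function.Injective fun n : ℕ => Real.cos (Real.pi / ((n + 2 : ℕ) : ℝ)) ^ 2 := by
  have bound (n : ℕ) : Real.pi / ((n + 2 : ℕ) : ℝ) ∈ Set.Icc 0 (Real.pi / 2) := by
    refine ⟨by positivity, ?_⟩
    gcongr
    simp
  have nonneg (n : ℕ) : 0 ≤ Real.cos (Real.pi / ((n + 2 : ℕ) : ℝ)) :=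
    Real.cos_nonneg_of_mem_Icc ⟨by linarith [(bound n).1, Real.pi_pos], (bound n).2⟩
  have mem_pi (n : ℕ) : Real.pi / ((n + 2 : ℕ) : ℝ) ∈ Set.Icc 0 Real.pi :=
    ⟨(bound n).1, (bound n).2.trans (by linarith [Real.pi_pos])⟩
  intro a b h
  have hcos := (sq_eq_sq₀ (nonneg a) (nonneg b)).1 h
  have hdiv := Real.injOn_cos (mem_pi a) (mem_pi b) hcos
  rw [div_eq_mul_inv, div_eq_mul_inv, mul_right_inj' Real.pi_ne_zero, inv_inj, Nat.cast_inj] at hdiv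
  omega

/-- Some `cos² (π / m)` with `m ≥ 2` is not an eigenvalue of a given endomorphism. -/
theorem exists_cos_pi_div_sq_not_hasEigenvalue {V : Type*} [AddCommGroup V] [Module ℝ V]
    [FiniteDimensional ℝ V] (T : Module.End ℝ V) :
    ∃ m : ℕ, 2 ≤ m ∧ ¬ T.HasEigenvalue (Real.cos (Real.pi / m) ^ 2) := by
  by_contra! h
  exact Set.infinite_range_of_injective cos_pi_div_sq_injective
    (T.finite_hasEigenvalue.subset (by rintro _ ⟨n, rfl⟩; exact h (n + 2) (by omega)))

/-- **Lemma 3.2.** Every Coxeter matrix over a finite set embeds as a full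
submatrix of a Coxeter matrix over a larger finite set whose canonical bilinear form is
non-degenerate. -/
theorem exists_extension_with_nondegenerate_form
    (B : Type) [Fintype B] (M : CoxeterMatrix B) :
    ∃ (B' : Type) (i : Fintype B') (f : B ↪ B') (M' : CoxeterMatrix B'),
      (∀ s t : B, M' (f s) (f t) = M s t) ∧
      (∀ x : B' → ℝ, (∀ y : B' → ℝ, @canonicalForm B' i M' x y = 0) → x = 0) := by
  classical
  let T : Module.End ℝ (B → ℝ) := Matrix.vecMulLinear (Matrix.of (formEntry M))
  obtain ⟨m, hm, hT⟩ := exists_cos_pi_div_sq_not_hasEigenvalue T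
  have h0 : m ≠ 0 := by omega
  refine ⟨B ⊕ B, inferInstance, .inl, pendantExtension M m (by omega), fun _ _ => rfl, ?_⟩
  intro x hx
  have hinl (t : B) := hx (Pi.single (.inl t) 1)
  have hinr (t : B) := hx (Pi.single (.inr t) 1)
  simp only [canonicalForm_single_right, Fintype.sum_sum_type, formEntry_pendantExtension_inl_inl,
    formEntry_pendantExtension_inl_inr _ _ _ _ _ h0,
    formEntry_pendantExtension_inr_inl _ _ _ _ _ h0, formEntry_pendantExtension_inr_inr,
    mul_ite, mul_zero, mul_one, Finset.sum_ite_eq', Finset.mem_univ, if_true] at hinl hinr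
  have hu : x ∘ Sum.inl = 0 := by
    by_contra hne
    refine hT (Module.End.hasEigenvalue_of_hasEigenvector
      ⟨Module.End.mem_eigenspace_iff.2 (funext fun t => ?_), hne⟩)
    simp only [T, Matrix.vecMulLinear_apply, Matrix.vecMul, dotProduct, Function.comp_apply,
      Matrix.of_apply, Pi.smul_apply, smul_eq_mul]
    linear_combination hinl t + Real.cos (Real.pi / m) * hinr t
  have hl (s : B) : x (.inl s) = 0 := congrFun hu s
  ext (s | s)
  · exact hl s
  · simpa [hl] using hinr s

end CoxeterPaper
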